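/- arXiv:2006.09516 — 5 statements merged into one kernel-verified Lean document; each statement's English description precedes it below -/
import Mathlib

section
/- The peaked profile φ satisfies the stationary Camassa–Holm equation −c φ(x) + (1/2)φ(x)² + (3/4)(φ∗φ²)(x) = d for all x ∈ T, with the uniquely determined constants c = M = coth(π) and d = m² = csch(π)², where (φ∗φ²)(x) = ∫_{−π}^{π} φ(x−y) φ(y)² dy. -/
open Real MeasureTheory Set Filter Topology

/-- The map sending `x` to its representative in `[-π, π)` (2π-periodic wrapping). -/
noncomputable def wrap (x : ℝ) : ℝ := x - 2 * π * (⌊(x + π) / (2 * π)⌋ : ℝ)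

/-- The peaked periodic profile `φ(x) = cosh(π - |x|)/sinh π`, extended 2π-periodically. -/
noncomputable def peak (x : ℝ) : ℝ := Real.cosh (π - |wrap x|) / Real.sinh π

/-- The piecewise derivative `φ'(x) = -sign(x) sinh(π - |x|)/sinh π`, extended 2π-periodically. -/
noncomputable def peak' (x : ℝ) : ℝ :=
  -Real.sign (wrap x) * Real.sinh (π - |wrap x|) / Real.sinh π

/-- `M = coth π = φ(0)`. -/
noncomputable def Mc : ℝ := Real.cosh π / Real.sinh π

/-- `m = csch π = φ(±π)`. -/
noncomputable def mc : ℝ := 1 / Real.sinh π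

/-- Membership in `H¹_per(T)`: `u` is continuous, `2π`-periodic, with weak derivative `du`
(periodic, locally integrable, square integrable over a period, and `u` is its primitive). -/
def IsH1per (u du : ℝ → ℝ) : Prop :=
  Function.Periodic u (2 * π) ∧ Function.Periodic du (2 * π) ∧ Continuous u ∧
    (∀ a b : ℝ, IntervalIntegrable du volume a b) ∧
    (∀ x : ℝ, u x = u 0 + ∫ y in (0:ℝ)..x, du y) ∧
    IntervalIntegrable (fun y => (du y) ^ 2) volume (-π) π

theorem peak_periodic : Function.Periodic peak (2 * π) := by
  intro x
  have h : (x + 2 * π + π) / (2 * π) = (x + π) / (2 * π) + 1 := by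
    field_simp
    ring
  unfold peak wrap
  rw [h, Int.floor_add_one]
  push_cast
  ring_nf

theorem peak_of_mem_Icc {t : ℝ} (h0 : 0 ≤ t) (h1 : t ≤ 2 * π) :
    peak t = cosh (π - t) / sinh π := by
  have hπ := pi_pos
  unfold peak wrap
  rcases lt_or_ge t π with h | h
  · have hf : ⌊(t + π) / (2 * π)⌋ = 0 := by
      rw [Int.floor_eq_iff]
      constructor
      · push_cast
        positivity
      · rw [div_lt_iff₀ (by positivity)]
        push_cast
        linarith
    rw [hf, Int.cast_zero, mul_zero, sub_zero, abs_of_nonneg h0]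
  · have hf : ⌊(t + π) / (2 * π)⌋ = 1 := by
      rw [Int.floor_eq_iff]
      constructor
      · rw [le_div_iff₀ (by positivity)]
        push_cast
        linarith
      · rw [div_lt_iff₀ (by positivity)]
        push_cast
        linarith
    rw [hf, Int.cast_one, mul_one, abs_of_nonpos (by linarith), ← cosh_neg]
    ring_nf

theorem integral_cosh_add_mul_cosh_sq (α a b : ℝ) :
    ∫ y in a..b, cosh (y - π + α) * cosh (π - y) ^ 2 =
      (sinh (b - π + α) / 2 + sinh (3 * (b - π) + α) / 12 + sinh (b - π - α) / 4) -
        (sinh (a - π + α) / 2 + sinh (3 * (a - π) + α) / 12 + sinh (a - π - α) / 4) := by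
  refine intervalIntegral.integral_eq_sub_of_hasDerivAt
    (f := fun y => sinh (y - π + α) / 2 + sinh (3 * (y - π) + α) / 12 + sinh (y - π - α) / 4)
    (fun y _ => ?_) (Continuous.intervalIntegrable (by fun_prop) _ _)
  have hu : HasDerivAt (fun y : ℝ => y - π) 1 y := (hasDerivAt_id y).sub_const π
  have h := (((hu.add_const α).sinh.div_const 2).add
    (((hu.const_mul 3).add_const α).sinh.div_const 12)).add ((hu.sub_const α).sinh.div_const 4)
  refine h.congr_deriv ?_
  rw [show π - y = -(y - π) by ring, cosh_neg]
  generalize y - π = u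
  rw [cosh_add, cosh_add, cosh_sub, cosh_three_mul, sinh_three_mul]
  have hs := cosh_sq u
  have hs3 : sinh u ^ 3 = sinh u * (cosh u ^ 2 - 1) := by rw [hs]; ring
  rw [hs3]
  ring

/-- The convolution `φ ∗ φ²` on the fundamental domain `[0, 2π]`. -/
theorem integral_peak_sub_mul_peak_sq {w : ℝ} (h0 : 0 ≤ w) (h1 : w ≤ 2 * π) :
    ∫ y in (-π)..π, peak (w - y) * peak y ^ 2 =
      (sinh π - sinh π * cosh (2 * (π - w)) / 3 + 2 / 3 * sinh (2 * π) * cosh (π - w)) /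
        sinh π ^ 3 := by
  have hπ := pi_pos
  have hper : Function.Periodic (fun y => peak (w - y) * peak y ^ 2) (2 * π) := by
    intro y
    simp only
    rw [peak_periodic y, show w - (y + 2 * π) = w - y - 2 * π by ring,
      peak_periodic.sub_eq]
  have hshift := hper.intervalIntegral_add_eq (-π) 0
  rw [show -π + 2 * π = π by ring, zero_add] at hshift
  rw [hshift]
  have hl : EqOn (fun y => peak (w - y) * peak y ^ 2)
      (fun y => cosh (y - π + (2 * π - w)) * cosh (π - y) ^ 2 / sinh π ^ 3) (uIcc 0 w) := by
    intro y hy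
    rw [uIcc_of_le h0] at hy
    simp only
    rw [peak_of_mem_Icc (by linarith [hy.2]) (by linarith [hy.1]),
      peak_of_mem_Icc hy.1 (by linarith [hy.2]),
      show y - π + (2 * π - w) = π - (w - y) by ring]
    ring
  have hr : EqOn (fun y => peak (w - y) * peak y ^ 2)
      (fun y => cosh (y - π + -w) * cosh (π - y) ^ 2 / sinh π ^ 3) (uIcc w (2 * π)) := by
    intro y hy
    rw [uIcc_of_le h1] at hy
    simp only
    rw [← peak_periodic (w - y), peak_of_mem_Icc (by linarith [hy.2]) (by linarith [hy.1]),
      peak_of_mem_Icc (by linarith [hy.1]) hy.2,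
      show y - π + -w = π - (w - y + 2 * π) by ring]
    ring
  have hil : IntervalIntegrable (fun y => peak (w - y) * peak y ^ 2) volume 0 w :=
    (Continuous.intervalIntegrable (by fun_prop) _ _).congr (hl.symm.mono uIoc_subset_uIcc)
  have hir : IntervalIntegrable (fun y => peak (w - y) * peak y ^ 2) volume w (2 * π) :=
    (Continuous.intervalIntegrable (by fun_prop) _ _).congr (hr.symm.mono uIoc_subset_uIcc)
  rw [← intervalIntegral.integral_add_adjacent_intervals hil hir,
    intervalIntegral.integral_congr hl, intervalIntegral.integral_congr hr,
    intervalIntegral.integral_div, intervalIntegral.integral_div,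
    integral_cosh_add_mul_cosh_sq, integral_cosh_add_mul_cosh_sq, ← add_div]
  congr 1
  obtain ⟨s, rfl⟩ : ∃ s, w = π - s := ⟨π - w, by ring⟩
  rw [show π - s - π + (2 * π - (π - s)) = π by ring,
    show 3 * (π - s - π) + (2 * π - (π - s)) = π - 2 * s by ring,
    show π - s - π - (2 * π - (π - s)) = -(π + 2 * s) by ring,
    show 0 - π + (2 * π - (π - s)) = s by ring,
    show 3 * (0 - π) + (2 * π - (π - s)) = -(2 * π - s) by ring,
    show 0 - π - (2 * π - (π - s)) = -(2 * π + s) by ring,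
    show 2 * π - π + -(π - s) = s by ring,
    show 3 * (2 * π - π) + -(π - s) = 2 * π + s by ring,
    show 2 * π - π - -(π - s) = 2 * π - s by ring,
    show π - s - π + -(π - s) = -π by ring,
    show 3 * (π - s - π) + -(π - s) = -(π + 2 * s) by ring,
    show π - s - π - -(π - s) = π - 2 * s by ring,
    show π - (π - s) = s by ring]
  simp only [sinh_neg, sinh_add, sinh_sub]
  ring

/-- the peaked profile `φ` satisfies the stationary Camassa–Holm equation
`-c φ + (1/2) φ² + (3/4) φ ∗ φ² = d` on `T`, with the uniquely determined constants
`c = M = coth π` and `d = m² = csch² π`. -/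
theorem stationary_CH_equation :
    (∀ x : ℝ, -Mc * peak x + (1 / 2) * (peak x) ^ 2
        + (3 / 4) * (∫ y in (-π)..π, peak (x - y) * (peak y) ^ 2) = mc ^ 2) ∧
      (∀ c d : ℝ,
        (∀ x : ℝ, -c * peak x + (1 / 2) * (peak x) ^ 2
          + (3 / 4) * (∫ y in (-π)..π, peak (x - y) * (peak y) ^ 2) = d) →
        c = Mc ∧ d = mc ^ 2) := by
  have hπ := pi_pos
  have hS : sinh π ≠ 0 := (sinh_pos_iff.2 hπ).ne'
  have hex : ∀ x : ℝ, -Mc * peak x + (1 / 2) * (peak x) ^ 2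
      + (3 / 4) * (∫ y in (-π)..π, peak (x - y) * (peak y) ^ 2) = mc ^ 2 := by
    have hper : Function.Periodic (fun x => -Mc * peak x + (1 / 2) * (peak x) ^ 2
        + (3 / 4) * (∫ y in (-π)..π, peak (x - y) * (peak y) ^ 2)) (2 * π) := by
      intro x
      have h (y : ℝ) : peak (x + 2 * π - y) = peak (x - y) := by
        rw [add_sub_right_comm, peak_periodic]
      simp only [h, peak_periodic x]
    intro x
    obtain ⟨w, hw, hxw⟩ := hper.exists_mem_Ico₀ (by positivity) x
    refine hxw.trans ?_
    rw [integral_peak_sub_mul_peak_sq hw.1 hw.2.le, peak_of_mem_Icc hw.1 hw.2.le,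
      cosh_two_mul, sinh_two_mul, sinh_sq (π - w), Mc, mc]
    field_simp
    ring
  refine ⟨hex, fun c d h => ?_⟩
  have hdiff (x : ℝ) : (Mc - c) * peak x = d - mc ^ 2 := by linarith [hex x, h x]
  have h0 := hdiff 0
  have hp := hdiff π
  rw [peak_of_mem_Icc le_rfl (by positivity), sub_zero] at h0
  rw [peak_of_mem_Icc hπ.le (by linarith), sub_self, cosh_zero] at hp
  have hne : cosh π / sinh π - 1 / sinh π ≠ 0 := by
    rw [← sub_div]
    exact div_ne_zero (sub_pos.2 (one_lt_cosh.2 hπ.ne')).ne' hS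
  have hc : Mc - c = 0 :=
    (mul_eq_zero.1 (show (Mc - c) * (cosh π / sinh π - 1 / sinh π) = 0 by
      linarith)).resolve_right hne
  rw [hc, zero_mul] at h0
  exact ⟨by linarith, by linarith⟩
end

section
/- For every x ∈ (0, 2π), the periodic convolution of φ with φ² evaluates explicitly as (φ∗φ²)(x) = (m²/3)[3 + 4 cosh(π) cosh(π−x) − cosh(2π−2x)], where on (0,2π) one has φ(x) = m cosh(π−x) with m = csch(π). -/
open Real MeasureTheory Set Filter Topology

theorem wrap_periodic : Function.Periodic wrap (2 * π) := by
  intro x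
  have h : (x + 2 * π + π) / (2 * π) = (x + π) / (2 * π) + 1 := by
    field_simp
    ring
  unfold wrap
  rw [h, Int.floor_add_one]
  push_cast
  ring

theorem peak_eq_of_mem_Icc {z : ℝ} (hz : z ∈ Icc 0 (2 * π)) :
    peak z = mc * cosh (π - z) := by
  obtain ⟨h0, h1⟩ := hz
  have hpi := pi_pos
  rcases lt_or_ge z π with h | h
  · have hf : ⌊(z + π) / (2 * π)⌋ = 0 := by
      rw [Int.floor_eq_iff, le_div_iff₀ (by positivity), div_lt_iff₀ (by positivity)]
      push_cast
      constructor <;> linarith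
    have hw : wrap z = z := by simp [wrap, hf]
    rw [peak, hw, abs_of_nonneg h0, mc]
    ring
  · have hf : ⌊(z + π) / (2 * π)⌋ = 1 := by
      rw [Int.floor_eq_iff, le_div_iff₀ (by positivity), div_lt_iff₀ (by positivity)]
      push_cast
      constructor <;> linarith
    have hw : wrap z = z - 2 * π := by simp [wrap, hf]
    rw [peak, hw, abs_of_nonpos (by linarith), mc, ← cosh_neg (π - z),
      show π - -(z - 2 * π) = -(π - z) by ring]
    ring

theorem peak_eq_of_mem_Icc_neg {z : ℝ} (hz : z ∈ Icc (-(2 * π)) 0) :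
    peak z = mc * cosh (π + z) := by
  rw [← peak_periodic z, peak_eq_of_mem_Icc ⟨by linarith [hz.1], by linarith [hz.2]⟩,
    ← cosh_neg (π + z), show π - (z + 2 * π) = -(π + z) by ring]

theorem cosh_mul_cosh_sq (a b : ℝ) :
    cosh a * cosh b ^ 2 = cosh a / 2 + cosh (a + 2 * b) / 4 + cosh (a - 2 * b) / 4 := by
  rw [cosh_add, cosh_sub, cosh_two_mul, sinh_sq]
  ring

theorem integral_cosh_add_mul_cosh_sub_sq (c d a b : ℝ) :
    ∫ y in a..b, cosh (c + y) * cosh (d - y) ^ 2 =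
      (sinh (c + b) / 2 - sinh (c + 2 * d - b) / 4 + sinh (c - 2 * d + 3 * b) / 12) -
      (sinh (c + a) / 2 - sinh (c + 2 * d - a) / 4 + sinh (c - 2 * d + 3 * a) / 12) := by
  refine intervalIntegral.integral_eq_sub_of_hasDerivAt
    (f := fun y => sinh (c + y) / 2 - sinh (c + 2 * d - y) / 4 + sinh (c - 2 * d + 3 * y) / 12)
    (fun y _ => ?_) (Continuous.intervalIntegrable (by fun_prop) _ _)
  have h1 := ((hasDerivAt_id y).const_add c).sinh.div_const 2
  have h2 := ((hasDerivAt_id y).const_sub (c + 2 * d)).sinh.div_const 4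
  have h3 := (((hasDerivAt_id y).const_mul 3).const_add (c - 2 * d)).sinh.div_const 12
  refine ((h1.sub h2).add h3).congr_deriv ?_
  simp only [id]
  rw [cosh_mul_cosh_sq, show c + y + 2 * (d - y) = c + 2 * d - y by ring,
    show c + y - 2 * (d - y) = c - 2 * d + 3 * y by ring]
  ring

theorem integral_cosh_sub_mul_cosh_sub_sq (c d a b : ℝ) :
    ∫ y in a..b, cosh (c - y) * cosh (d - y) ^ 2 =
      (-sinh (c - b) / 2 - sinh (c + 2 * d - 3 * b) / 12 + sinh (c - 2 * d + b) / 4) -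
      (-sinh (c - a) / 2 - sinh (c + 2 * d - 3 * a) / 12 + sinh (c - 2 * d + a) / 4) := by
  refine intervalIntegral.integral_eq_sub_of_hasDerivAt
    (f := fun y => -sinh (c - y) / 2 - sinh (c + 2 * d - 3 * y) / 12 + sinh (c - 2 * d + y) / 4)
    (fun y _ => ?_) (Continuous.intervalIntegrable (by fun_prop) _ _)
  have h1 := ((hasDerivAt_id y).const_sub c).sinh.neg.div_const 2
  have h2 := (((hasDerivAt_id y).const_mul 3).const_sub (c + 2 * d)).sinh.div_const 12
  have h3 := ((hasDerivAt_id y).const_add (c - 2 * d)).sinh.div_const 4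
  refine ((h1.sub h2).add h3).congr_deriv ?_
  simp only [id]
  rw [cosh_mul_cosh_sq, show c - y + 2 * (d - y) = c + 2 * d - 3 * y by ring,
    show c - y - 2 * (d - y) = c - 2 * d + y by ring]
  ring

/-- for `x ∈ (0, 2π)` one has `φ(x) = m cosh(π - x)` and the periodic
convolution evaluates explicitly as
`(φ ∗ φ²)(x) = (m²/3) [3 + 4 cosh π cosh(π - x) - cosh(2π - 2x)]`. -/
theorem convolution_phi_phi_sq :
    ∀ x ∈ Set.Ioo (0:ℝ) (2 * π),
      peak x = mc * Real.cosh (π - x) ∧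
      (∫ y in (-π)..π, peak (x - y) * (peak y) ^ 2)
        = mc ^ 2 / 3 * (3 + 4 * Real.cosh π * Real.cosh (π - x) - Real.cosh (2 * π - 2 * x)) := by
  intro x hx
  obtain ⟨hx0, hx1⟩ := hx
  have hpi := pi_pos
  refine ⟨peak_eq_of_mem_Icc ⟨hx0.le, hx1.le⟩, ?_⟩
  have hper : Function.Periodic (fun y => peak (x - y) * peak y ^ 2) (2 * π) := by
    intro y
    have h : peak (x - (y + 2 * π)) = peak (x - y) := by
      rw [← sub_sub, peak_periodic.sub_eq]
    simp only [h, peak_periodic y]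
  have hshift := hper.intervalIntegral_add_eq (-π) 0
  rw [show -π + 2 * π = π by ring, zero_add] at hshift
  have e1 : EqOn (fun y => mc ^ 3 * (cosh (π - x + y) * cosh (π - y) ^ 2))
      (fun y => peak (x - y) * peak y ^ 2) (uIcc 0 x) := by
    intro y hy
    rw [uIcc_of_le hx0.le] at hy
    simp only
    rw [peak_eq_of_mem_Icc (z := x - y) ⟨by linarith [hy.2], by linarith [hy.1]⟩,
      peak_eq_of_mem_Icc (z := y) ⟨hy.1, by linarith [hy.2]⟩,
      show π - (x - y) = π - x + y by ring]
    ring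
  have e2 : EqOn (fun y => mc ^ 3 * (cosh (π + x - y) * cosh (π - y) ^ 2))
      (fun y => peak (x - y) * peak y ^ 2) (uIcc x (2 * π)) := by
    intro y hy
    rw [uIcc_of_le hx1.le] at hy
    simp only
    rw [peak_eq_of_mem_Icc_neg (z := x - y) ⟨by linarith [hy.2], by linarith [hy.1]⟩,
      peak_eq_of_mem_Icc (z := y) ⟨by linarith [hy.1], hy.2⟩,
      show π + (x - y) = π + x - y by ring]
    ring
  have i1 : IntervalIntegrable (fun y => peak (x - y) * peak y ^ 2) volume 0 x :=
    (ContinuousOn.congr (by fun_prop) e1.symm).intervalIntegrable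
  have i2 : IntervalIntegrable (fun y => peak (x - y) * peak y ^ 2) volume x (2 * π) :=
    (ContinuousOn.congr (by fun_prop) e2.symm).intervalIntegrable
  rw [hshift, ← intervalIntegral.integral_add_adjacent_intervals i1 i2,
    ← intervalIntegral.integral_congr e1, ← intervalIntegral.integral_congr e2,
    intervalIntegral.integral_const_mul, intervalIntegral.integral_const_mul,
    integral_cosh_add_mul_cosh_sub_sq, integral_cosh_sub_mul_cosh_sub_sq]
  have hm : mc * sinh π = 1 := one_div_mul_cancel (sinh_pos_iff.2 hpi).ne'
  obtain ⟨w, rfl⟩ : ∃ w, x = π - w := ⟨π - x, by ring⟩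
  generalize π = p at hm ⊢
  rw [show p - (p - w) + (p - w) = p by ring,
    show p - (p - w) + 2 * p - (p - w) = p + 2 * w by ring,
    show p - (p - w) - 2 * p + 3 * (p - w) = p - 2 * w by ring,
    show p - (p - w) + 0 = w by ring,
    show p - (p - w) + 2 * p - 0 = 2 * p + w by ring,
    show p - (p - w) - 2 * p + 3 * 0 = -(2 * p - w) by ring,
    show p + (p - w) - 2 * p = -w by ring,
    show p + (p - w) + 2 * p - 3 * (2 * p) = -(2 * p + w) by ring,
    show -w + 2 * p = 2 * p - w by ring,
    show p + (p - w) - (p - w) = p by ring,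
    show p + (p - w) + 2 * p - 3 * (p - w) = p + 2 * w by ring,
    show -w + (p - w) = p - 2 * w by ring,
    show p - (p - w) = w by ring,
    show 2 * p - 2 * (p - w) = 2 * w by ring]
  simp only [sinh_neg, sinh_add, sinh_sub, sinh_two_mul]
  linear_combination
    (mc ^ 2 / 3 * (3 + 4 * cosh p * cosh w - cosh (2 * w))) * hm
end

section
/- For every v ∈ H¹_per(T) and every x ∈ T, the following identity holds: [v(0) − v(x)] φ'(x) − (φ'∗(φ v))(x) − (1/2)(φ'∗(φ' v'))(x) = φ(x) ∫₀ˣ v(y) dy − (1/2) m² sinh(x) ∫_{−π}^{π} v(y) dy. -/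
open Real MeasureTheory Set Filter Topology

theorem wrap_eq_sub {z : ℝ} (k : ℤ) (h₁ : (2 * k - 1) * π ≤ z) (h₂ : z < (2 * k + 1) * π) :
    wrap z = z - 2 * π * k := by
  have hfloor : ⌊(z + π) / (2 * π)⌋ = k := by
    have : 0 < 2 * π := by positivity
    rw [Int.floor_eq_iff, le_div_iff₀ this, div_lt_iff₀ this]
    constructor <;> linarith
  rw [wrap, hfloor]

theorem peak_eq_of_nonneg {z : ℝ} (h₁ : 0 ≤ z) (h₂ : z < 2 * π) :
    peak z = cosh (z - π) / sinh π := by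
  rcases lt_or_ge z π with h | h
  · rw [peak, wrap_eq_sub 0 (by push_cast; linarith) (by push_cast; linarith)]
    rw [Int.cast_zero, mul_zero, sub_zero, abs_of_nonneg h₁, ← cosh_neg, neg_sub]
  · rw [peak, wrap_eq_sub 1 (by push_cast; linarith) (by push_cast; linarith)]
    rw [Int.cast_one, abs_of_nonpos (by linarith)]
    ring_nf

theorem peak_eq_of_neg {z : ℝ} (h₁ : -(2 * π) < z) (h₂ : z < 0) :
    peak z = cosh (z + π) / sinh π := by
  rcases le_or_gt (-π) z with h | h
  · rw [peak, wrap_eq_sub 0 (by push_cast; linarith) (by push_cast; linarith)]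
    rw [Int.cast_zero, abs_of_nonpos (by linarith)]
    ring_nf
  · rw [peak, wrap_eq_sub (-1) (by push_cast; linarith) (by push_cast; linarith)]
    rw [Int.cast_neg, Int.cast_one, abs_of_nonneg (by linarith), ← cosh_neg]
    ring_nf

theorem peak'_eq_of_pos {z : ℝ} (h₁ : 0 < z) (h₂ : z < 2 * π) :
    peak' z = sinh (z - π) / sinh π := by
  rcases lt_trichotomy z π with h | rfl | h
  · rw [peak', wrap_eq_sub 0 (by push_cast; linarith) (by push_cast; linarith)]
    rw [Int.cast_zero, mul_zero, sub_zero, abs_of_pos h₁, Real.sign_of_pos h₁,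
      ← neg_sub π z, sinh_neg]
    ring
  · rw [peak', wrap_eq_sub 1 (by push_cast; linarith) (by push_cast; linarith)]
    rw [Int.cast_one, abs_of_nonpos (by linarith)]
    ring_nf
    simp
  · rw [peak', wrap_eq_sub 1 (by push_cast; linarith) (by push_cast; linarith)]
    rw [Int.cast_one, abs_of_neg (by linarith), Real.sign_of_neg (by linarith)]
    ring_nf

theorem peak'_eq_of_neg {z : ℝ} (h₁ : -(2 * π) < z) (h₂ : z < 0) :
    peak' z = sinh (z + π) / sinh π := by
  rcases lt_trichotomy z (-π) with h | rfl | h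
  · rw [peak', wrap_eq_sub (-1) (by push_cast; linarith) (by push_cast; linarith)]
    rw [Int.cast_neg, Int.cast_one, abs_of_pos (by linarith), Real.sign_of_pos (by linarith),
      show z + π = -(π - (z - 2 * π * -1)) by ring, sinh_neg]
    ring
  · rw [peak', wrap_eq_sub 0 (by push_cast; linarith) (by push_cast; linarith [pi_pos])]
    rw [Int.cast_zero, abs_of_nonpos (by linarith)]
    ring_nf
    simp
  · rw [peak', wrap_eq_sub 0 (by push_cast; linarith) (by push_cast; linarith)]
    rw [Int.cast_zero, mul_zero, sub_zero, abs_of_neg h₂, Real.sign_of_neg h₂]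
    ring_nf

/-- Integration by parts against an element of `H¹_per`. -/
theorem IsH1per.integral_mul_eq {v dv : ℝ → ℝ} (hv : IsH1per v dv) {K K' : ℝ → ℝ}
    (hK : ContDiff ℝ 1 K) (hK' : ∀ y, HasDerivAt K (K' y) y) (a b : ℝ) :
    ∫ y in a..b, K y * dv y = K b * v b - K a * v a - ∫ y in a..b, K' y * v y := by
  obtain ⟨-, -, -, hdv, hprim, -⟩ := hv
  have hva : v = fun y => v a + ∫ t in a..y, dv t := by
    funext y
    rw [hprim y, hprim a, add_assoc,
      intervalIntegral.integral_add_adjacent_intervals (hdv _ _) (hdv _ _)]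
  have hac : AbsolutelyContinuousOnInterval v a b := by
    rw [hva]
    exact (contDiff_const (n := 1)).contDiffOn.absolutelyContinuousOnInterval.fun_add
      ((hdv a b).absolutelyContinuousOnInterval_intervalIntegral left_mem_uIcc)
  have hderiv : ∀ᵐ y, y ∈ uIcc a b → deriv v y = dv y := by
    filter_upwards [(hdv a b).ae_hasDerivAt_integral] with y hy hyab
    rw [hva]
    exact ((hy hyab a left_mem_uIcc).const_add _).deriv
  have hibp := hK.contDiffOn.absolutelyContinuousOnInterval.integral_mul_deriv_eq_deriv_mul hac
  rw [show deriv K = K' from funext fun y => (hK' y).deriv] at hibp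
  rw [← hibp]
  apply intervalIntegral.integral_congr_ae
  filter_upwards [hderiv] with y hy hyab
  rw [hy (uIoc_subset_uIcc hyab)]

/-- On an interval where `φ'(x - ·)`, `φ` and `φ'` are given by single hyperbolic functions, the
contributions to the two convolutions are integrable and combine into boundary terms and a
multiple of `∫ v`. -/
theorem IsH1per.integral_interval {v dv : ℝ → ℝ} (hv : IsH1per v dv) {x a b c d : ℝ} (hab : a ≤ b)
    (hx : ∀ y ∈ Ioo a b, peak' (x - y) = sinh (x - y - c) / sinh π)
    (hp : ∀ y ∈ Ioo a b, peak y = cosh (y + d) / sinh π)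
    (hp' : ∀ y ∈ Ioo a b, peak' y = sinh (y + d) / sinh π) :
    IntervalIntegrable (fun y => peak' (x - y) * (peak y * v y)) volume a b ∧
    IntervalIntegrable (fun y => peak' (x - y) * (peak' y * dv y)) volume a b ∧
    (∫ y in a..b, peak' (x - y) * (peak y * v y))
        + (1 / 2) * (∫ y in a..b, peak' (x - y) * (peak' y * dv y)) =
      (1 / 2) * (sinh (x - b - c) * sinh (b + d) * v b - sinh (x - a - c) * sinh (a + d) * v a)
          / sinh π ^ 2
        + (1 / 2) * (sinh (x - c + d) / sinh π ^ 2) * ∫ y in a..b, v y := by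
  have hcont : Continuous v := hv.2.2.1
  have hdv : IntervalIntegrable dv volume a b := hv.2.2.2.1 a b
  have e₁ : EqOn (fun y => sinh (x - y - c) / sinh π * (cosh (y + d) / sinh π) * v y)
      (fun y => peak' (x - y) * (peak y * v y)) (Ioo a b) := fun y hy => by
    simp only [hx y hy, hp y hy, mul_assoc]
  have e₂ : EqOn (fun y => sinh (x - y - c) / sinh π * (sinh (y + d) / sinh π) * dv y)
      (fun y => peak' (x - y) * (peak' y * dv y)) (Ioo a b) := fun y hy => by
    simp only [hx y hy, hp' y hy, mul_assoc]
  have i₁ : IntervalIntegrable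
      (fun y => sinh (x - y - c) / sinh π * (cosh (y + d) / sinh π) * v y) volume a b :=
    Continuous.intervalIntegrable (by fun_prop) _ _
  have i₂ : IntervalIntegrable
      (fun y => sinh (x - y - c) / sinh π * (sinh (y + d) / sinh π) * dv y) volume a b :=
    hdv.continuousOn_mul (Continuous.continuousOn (by fun_prop))
  refine ⟨i₁.congr_uIoo (by rwa [uIoo_of_le hab]), i₂.congr_uIoo (by rwa [uIoo_of_le hab]), ?_⟩
  rw [← intervalIntegral.integral_congr_Ioo_of_le hab e₁,
    ← intervalIntegral.integral_congr_Ioo_of_le hab e₂]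
  have hK' : ∀ y, HasDerivAt (fun y => sinh (x - y - c) / sinh π * (sinh (y + d) / sinh π))
      ((-cosh (x - y - c) * sinh (y + d) + sinh (x - y - c) * cosh (y + d)) / sinh π ^ 2) y := by
    intro y
    have h₁ := ((((hasDerivAt_id y).const_sub x).sub_const c).sinh).div_const (sinh π)
    have h₂ := (((hasDerivAt_id y).add_const d).sinh).div_const (sinh π)
    refine (h₁.mul h₂).congr_deriv ?_
    simp only [id_eq]
    ring
  rw [hv.integral_mul_eq (by fun_prop) hK', mul_sub, ← intervalIntegral.integral_const_mul,
    ← intervalIntegral.integral_const_mul, add_sub_left_comm, ← intervalIntegral.integral_sub i₁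
      (Continuous.intervalIntegrable (by fun_prop) _ _)]
  congr 1
  · ring
  · refine intervalIntegral.integral_congr fun y _ => ?_
    have hsinh : sinh (x - c + d)
        = sinh (x - y - c) * cosh (y + d) + cosh (x - y - c) * sinh (y + d) := by
      rw [← sinh_add]
      ring_nf
    simp only [hsinh]
    ring

/-- for every `v ∈ H¹_per(T)` and every `x ∈ T = [-π, π]`,
`(v(0) - v(x)) φ'(x) - (φ' ∗ (φ v))(x) - (1/2)(φ' ∗ (φ' v'))(x)
  = φ(x) ∫₀ˣ v - (1/2) m² sinh x ∫_{-π}^{π} v`. -/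
theorem linearization_identity (v dv : ℝ → ℝ) (hv : IsH1per v dv) :
    ∀ x ∈ Set.Icc (-π) π,
      (v 0 - v x) * peak' x
          - (∫ y in (-π)..π, peak' (x - y) * (peak y * v y))
          - (1 / 2) * (∫ y in (-π)..π, peak' (x - y) * (peak' y * dv y))
        = peak x * (∫ y in (0:ℝ)..x, v y)
          - (1 / 2) * mc ^ 2 * Real.sinh x * (∫ y in (-π)..π, v y) := by
  intro x ⟨hx₁, hx₂⟩
  have hπ := pi_pos
  have hs : sinh π ≠ 0 := (sinh_pos_iff.2 hπ).ne'
  have hvi : ∀ a b, IntervalIntegrable v volume a b := fun a b => hv.2.2.1.intervalIntegrable a b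
  have hCS := cosh_sq π
  rcases le_or_gt 0 x with hx | hx
  · obtain ⟨i₁, j₁, h₁⟩ := hv.integral_interval (x := x) (a := -π) (b := 0) (c := π) (d := π)
      (by linarith)
      (fun y hy => peak'_eq_of_pos (by linarith [hy.1, hy.2]) (by linarith [hy.1, hy.2]))
      (fun y hy => peak_eq_of_neg (by linarith [hy.1, hy.2]) (by linarith [hy.1, hy.2]))
      (fun y hy => peak'_eq_of_neg (by linarith [hy.1, hy.2]) (by linarith [hy.1, hy.2]))
    obtain ⟨i₂, j₂, h₂⟩ := hv.integral_interval (x := x) (a := 0) (b := x) (c := π) (d := -π)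
      (by linarith)
      (fun y hy => peak'_eq_of_pos (by linarith [hy.1, hy.2]) (by linarith [hy.1, hy.2]))
      (fun y hy => peak_eq_of_nonneg (by linarith [hy.1, hy.2]) (by linarith [hy.1, hy.2]))
      (fun y hy => peak'_eq_of_pos (by linarith [hy.1, hy.2]) (by linarith [hy.1, hy.2]))
    obtain ⟨i₃, j₃, h₃⟩ := hv.integral_interval (x := x) (a := x) (b := π) (c := -π) (d := -π)
      (by linarith)
      (fun y hy => by
        rw [sub_neg_eq_add]
        exact peak'_eq_of_neg (by linarith [hy.1, hy.2]) (by linarith [hy.1, hy.2]))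
      (fun y hy => peak_eq_of_nonneg (by linarith [hy.1, hy.2]) (by linarith [hy.1, hy.2]))
      (fun y hy => peak'_eq_of_pos (by linarith [hy.1, hy.2]) (by linarith [hy.1, hy.2]))
    have hpx' : (v 0 - v x) * peak' x = (v 0 - v x) * (sinh (x - π) / sinh π) := by
      rcases hx.eq_or_lt with rfl | hx
      · simp
      · rw [peak'_eq_of_pos hx (by linarith)]
    rw [hpx', peak_eq_of_nonneg hx (by linarith), mc]
    rw [← intervalIntegral.integral_add_adjacent_intervals (i₁.trans i₂) i₃,
      ← intervalIntegral.integral_add_adjacent_intervals i₁ i₂,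
      ← intervalIntegral.integral_add_adjacent_intervals (j₁.trans j₂) j₃,
      ← intervalIntegral.integral_add_adjacent_intervals j₁ j₂,
      ← intervalIntegral.integral_add_adjacent_intervals
        ((hvi (-π) 0).trans (hvi _ x)) (hvi _ π),
      ← intervalIntegral.integral_add_adjacent_intervals (hvi (-π) 0) (hvi _ x)]
    simp only [sub_self, sub_zero, zero_sub, zero_add, sub_neg_eq_add, neg_add_cancel,
      add_neg_cancel, sub_add_cancel, sinh_zero, mul_zero, zero_mul, sinh_neg,
      sinh_add, sinh_sub, cosh_add, cosh_sub, cosh_neg] at h₁ h₂ h₃ ⊢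
    field_simp at h₁ h₂ h₃ ⊢
    linear_combination -h₁ - h₂ - h₃
      - sinh x * ((∫ y in (0:ℝ)..x, v y) + ∫ y in x..π, v y) * hCS
  · obtain ⟨i₁, j₁, h₁⟩ := hv.integral_interval (x := x) (a := -π) (b := x) (c := π) (d := π)
      (by linarith)
      (fun y hy => peak'_eq_of_pos (by linarith [hy.1, hy.2]) (by linarith [hy.1, hy.2]))
      (fun y hy => peak_eq_of_neg (by linarith [hy.1, hy.2]) (by linarith [hy.1, hy.2]))
      (fun y hy => peak'_eq_of_neg (by linarith [hy.1, hy.2]) (by linarith [hy.1, hy.2]))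
    obtain ⟨i₂, j₂, h₂⟩ := hv.integral_interval (x := x) (a := x) (b := 0) (c := -π) (d := π)
      (by linarith)
      (fun y hy => by
        rw [sub_neg_eq_add]
        exact peak'_eq_of_neg (by linarith [hy.1, hy.2]) (by linarith [hy.1, hy.2]))
      (fun y hy => peak_eq_of_neg (by linarith [hy.1, hy.2]) (by linarith [hy.1, hy.2]))
      (fun y hy => peak'_eq_of_neg (by linarith [hy.1, hy.2]) (by linarith [hy.1, hy.2]))
    obtain ⟨i₃, j₃, h₃⟩ := hv.integral_interval (x := x) (a := 0) (b := π) (c := -π) (d := -π)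
      (by linarith)
      (fun y hy => by
        rw [sub_neg_eq_add]
        exact peak'_eq_of_neg (by linarith [hy.1, hy.2]) (by linarith [hy.1, hy.2]))
      (fun y hy => peak_eq_of_nonneg (by linarith [hy.1, hy.2]) (by linarith [hy.1, hy.2]))
      (fun y hy => peak'_eq_of_pos (by linarith [hy.1, hy.2]) (by linarith [hy.1, hy.2]))
    rw [peak'_eq_of_neg (by linarith) hx, peak_eq_of_neg (by linarith) hx, mc,
      intervalIntegral.integral_symm x 0]
    rw [← intervalIntegral.integral_add_adjacent_intervals (i₁.trans i₂) i₃,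
      ← intervalIntegral.integral_add_adjacent_intervals i₁ i₂,
      ← intervalIntegral.integral_add_adjacent_intervals (j₁.trans j₂) j₃,
      ← intervalIntegral.integral_add_adjacent_intervals j₁ j₂,
      ← intervalIntegral.integral_add_adjacent_intervals
        ((hvi (-π) x).trans (hvi _ 0)) (hvi _ π),
      ← intervalIntegral.integral_add_adjacent_intervals (hvi (-π) x) (hvi _ 0)]
    simp only [sub_self, sub_zero, zero_sub, zero_add, sub_neg_eq_add, neg_add_cancel,
      add_neg_cancel, sub_add_cancel, sinh_zero, mul_zero, zero_mul, sinh_neg,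
      sinh_add, sinh_sub, cosh_add, cosh_neg] at h₁ h₂ h₃ ⊢
    field_simp at h₁ h₂ h₃ ⊢
    linear_combination -h₁ - h₂ - h₃
      - sinh x * ((∫ y in x..0, v y) + ∫ y in (0:ℝ)..π, v y) * hCS
end

section
/- For every v ∈ H¹_per(T), setting u = φ + v, the conserved functionals E(u) = ∫_T (u² + u_x²) dx and F(u) = ∫_T u(u² + u_x²) dx expand as: E(u) = E(φ) + 4 v(0) + E(v), and F(u) = F(φ) + 4M v(0) + m² ∫_T v dx + 2 ∫_T φ (v² + (1/2)v_x²) dx + 2 v(0)² + F(v). -/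
open Real MeasureTheory Set Filter Topology

theorem AbsolutelyContinuousOnInterval.integral_eq_sub_of_ae_hasDerivAt {f f' : ℝ → ℝ} {a b : ℝ}
    (hf : AbsolutelyContinuousOnInterval f a b) (h : ∀ᵐ x, x ∈ uIcc a b → HasDerivAt f (f' x) x) :
    ∫ x in a..b, f' x = f b - f a := by
  rw [← hf.integral_deriv_eq_sub]
  refine intervalIntegral.integral_congr_ae ?_
  filter_upwards [h] with x hx hmem
  exact (hx (uIoc_subset_uIcc hmem)).deriv.symm

theorem IsH1per.eq_add_integral {v dv : ℝ → ℝ} (hv : IsH1per v dv) (a : ℝ) :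
    v = fun x => v a + ∫ y in a..x, dv y := by
  obtain ⟨-, -, -, hint, hprim, -⟩ := hv
  funext x
  rw [hprim x, hprim a, add_assoc,
    intervalIntegral.integral_add_adjacent_intervals (hint _ _) (hint _ _)]

theorem IsH1per.absolutelyContinuousOnInterval {v dv : ℝ → ℝ} (hv : IsH1per v dv) (a b : ℝ) :
    AbsolutelyContinuousOnInterval v a b := by
  rw [hv.eq_add_integral a]
  have hconst : AbsolutelyContinuousOnInterval (fun _ : ℝ => v a) a b :=
    contDiff_const.contDiffOn.absolutelyContinuousOnInterval
  exact hconst.add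
    ((hv.2.2.2.1 a b).absolutelyContinuousOnInterval_intervalIntegral left_mem_uIcc)

theorem IsH1per.ae_hasDerivAt {v dv : ℝ → ℝ} (hv : IsH1per v dv) (a b : ℝ) :
    ∀ᵐ x, x ∈ uIcc a b → HasDerivAt v (dv x) x := by
  filter_upwards [(hv.2.2.2.1 a b).ae_hasDerivAt_integral] with x hx hmem
  rw [hv.eq_add_integral a]
  exact (hx hmem a left_mem_uIcc).const_add _

/-- Fundamental theorem of calculus for `p v + q v²` with `p`, `q` smooth and `v ∈ H¹_per(T)`. -/
theorem IsH1per.integral_deriv_add_sq {v dv p p' q q' : ℝ → ℝ} (hv : IsH1per v dv)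
    (hpC : ContDiff ℝ 1 p) (hqC : ContDiff ℝ 1 q)
    (hp : ∀ x, HasDerivAt p (p' x) x) (hq : ∀ x, HasDerivAt q (q' x) x) (a b : ℝ) :
    ∫ x in a..b, (p' x * v x + p x * dv x + (q' x * v x ^ 2 + 2 * q x * v x * dv x)) =
      (p b * v b + q b * v b ^ 2) - (p a * v a + q a * v a ^ 2) := by
  have hac := hv.absolutelyContinuousOnInterval a b
  have hG : AbsolutelyContinuousOnInterval (p * v + q * (v * v)) a b :=
    (hpC.contDiffOn.absolutelyContinuousOnInterval.mul hac).add
      (hqC.contDiffOn.absolutelyContinuousOnInterval.mul (hac.mul hac))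
  rw [hG.integral_eq_sub_of_ae_hasDerivAt]
  · simp only [Pi.add_apply, Pi.mul_apply]
    ring
  · filter_upwards [hv.ae_hasDerivAt a b] with x hx hmem
    have hd := hx hmem
    refine (((hp x).mul hd).add ((hq x).mul (hd.mul hd))).congr_deriv ?_
    simp only [Pi.mul_apply]
    ring

theorem IsH1per.intervalIntegrable_quadratic {v dv α β γ f : ℝ → ℝ} (hv : IsH1per v dv) {a b : ℝ}
    (hsub : uIcc a b ⊆ uIcc (-π) π) (hα : Continuous α) (hβ : Continuous β) (hγ : Continuous γ)
    (hf : ∀ x ∈ uIoo a b, α x + β x * dv x + γ x * dv x ^ 2 = f x) :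
    IntervalIntegrable f volume a b := by
  obtain ⟨-, -, -, hint, -, hsq⟩ := hv
  exact (((hα.intervalIntegrable a b).add ((hint a b).continuousOn_mul hβ.continuousOn)).add
    ((hsq.mono_set hsub).continuousOn_mul hγ.continuousOn)).congr_uIoo hf

section Half

variable {v dv c s P Q : ℝ → ℝ} {a b : ℝ}

theorem IsH1per.energy_expansion_interval (hv : IsH1per v dv)
    (hsub : uIcc a b ⊆ uIcc (-π) π) (hsC : ContDiff ℝ 1 s) (hcC : ContDiff ℝ 1 c)
    (hs : ∀ x, HasDerivAt s (c x) x)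
    (hP : ∀ x ∈ uIoo a b, P x = c x) (hQ : ∀ x ∈ uIoo a b, Q x = s x) :
    IntervalIntegrable (fun x => (P x + v x) ^ 2 + (Q x + dv x) ^ 2) volume a b ∧
    IntervalIntegrable (fun x => P x ^ 2 + Q x ^ 2) volume a b ∧
    IntervalIntegrable (fun x => v x ^ 2 + dv x ^ 2) volume a b ∧
    ∫ x in a..b, ((P x + v x) ^ 2 + (Q x + dv x) ^ 2) =
      (∫ x in a..b, (P x ^ 2 + Q x ^ 2)) + 2 * (s b * v b - s a * v a)
        + ∫ x in a..b, (v x ^ 2 + dv x ^ 2) := by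
  have hvc : Continuous v := hv.2.2.1
  have hcc := hcC.continuous
  have hsc := hsC.continuous
  have h1 : IntervalIntegrable (fun x => (P x + v x) ^ 2 + (Q x + dv x) ^ 2) volume a b :=
    hv.intervalIntegrable_quadratic (α := fun x => (c x + v x) ^ 2 + s x ^ 2)
      (β := fun x => 2 * s x) (γ := fun _ => 1) hsub (by fun_prop) (by fun_prop) (by fun_prop)
      fun x hx => by rw [hP x hx, hQ x hx]; ring
  have h2 : IntervalIntegrable (fun x => P x ^ 2 + Q x ^ 2) volume a b :=
    hv.intervalIntegrable_quadratic (α := fun x => c x ^ 2 + s x ^ 2)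
      (β := fun _ => 0) (γ := fun _ => 0) hsub (by fun_prop) (by fun_prop) (by fun_prop)
      fun x hx => by rw [hP x hx, hQ x hx]; ring
  have h3 : IntervalIntegrable (fun x => v x ^ 2 + dv x ^ 2) volume a b :=
    hv.intervalIntegrable_quadratic (α := fun x => v x ^ 2)
      (β := fun _ => 0) (γ := fun _ => 1) hsub (by fun_prop) (by fun_prop) (by fun_prop)
      fun x hx => by ring
  refine ⟨h1, h2, h3, ?_⟩
  have hftc := hv.integral_deriv_add_sq (p := fun x => 2 * s x) (q := fun _ => 0)
    (by fun_prop) (by fun_prop) (fun x => (hs x).const_mul 2)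
    (fun x => hasDerivAt_const x (0 : ℝ)) a b
  rw [← intervalIntegral.integral_congr_uIoo (f := fun x =>
    ((P x + v x) ^ 2 + (Q x + dv x) ^ 2) - (P x ^ 2 + Q x ^ 2) - (v x ^ 2 + dv x ^ 2))
    fun x hx => by simp only [hP x hx, hQ x hx]; ring,
    intervalIntegral.integral_sub (h1.sub h2) h3, intervalIntegral.integral_sub h1 h2] at hftc
  linear_combination hftc

theorem IsH1per.cubic_energy_expansion_interval (hv : IsH1per v dv) {k : ℝ}
    (hsub : uIcc a b ⊆ uIcc (-π) π) (hsC : ContDiff ℝ 1 s) (hcC : ContDiff ℝ 1 c)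
    (hs : ∀ x, HasDerivAt s (c x) x) (hc : ∀ x, HasDerivAt c (s x) x)
    (hk : ∀ x, c x ^ 2 - s x ^ 2 = k)
    (hP : ∀ x ∈ uIoo a b, P x = c x) (hQ : ∀ x ∈ uIoo a b, Q x = s x) :
    IntervalIntegrable (fun x => (P x + v x) * ((P x + v x) ^ 2 + (Q x + dv x) ^ 2)) volume a b ∧
    IntervalIntegrable (fun x => P x * (P x ^ 2 + Q x ^ 2)) volume a b ∧
    IntervalIntegrable (fun x => P x * (v x ^ 2 + (1 / 2) * dv x ^ 2)) volume a b ∧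
    IntervalIntegrable (fun x => v x * (v x ^ 2 + dv x ^ 2)) volume a b ∧
    ∫ x in a..b, (P x + v x) * ((P x + v x) ^ 2 + (Q x + dv x) ^ 2) =
      (∫ x in a..b, P x * (P x ^ 2 + Q x ^ 2))
        + 2 * (c b * s b * v b - c a * s a * v a) + k * (∫ x in a..b, v x)
        + 2 * (∫ x in a..b, P x * (v x ^ 2 + (1 / 2) * dv x ^ 2))
        + (s b * v b ^ 2 - s a * v a ^ 2)
        + ∫ x in a..b, v x * (v x ^ 2 + dv x ^ 2) := by
  have hvc : Continuous v := hv.2.2.1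
  have hcc := hcC.continuous
  have hsc := hsC.continuous
  have h1 : IntervalIntegrable
      (fun x => (P x + v x) * ((P x + v x) ^ 2 + (Q x + dv x) ^ 2)) volume a b :=
    hv.intervalIntegrable_quadratic (α := fun x => (c x + v x) * ((c x + v x) ^ 2 + s x ^ 2))
      (β := fun x => (c x + v x) * (2 * s x)) (γ := fun x => c x + v x)
      hsub (by fun_prop) (by fun_prop) (by fun_prop)
      fun x hx => by rw [hP x hx, hQ x hx]; ring
  have h2 : IntervalIntegrable (fun x => P x * (P x ^ 2 + Q x ^ 2)) volume a b :=
    hv.intervalIntegrable_quadratic (α := fun x => c x * (c x ^ 2 + s x ^ 2))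
      (β := fun _ => 0) (γ := fun _ => 0) hsub (by fun_prop) (by fun_prop) (by fun_prop)
      fun x hx => by rw [hP x hx, hQ x hx]; ring
  have h3 : IntervalIntegrable (fun x => P x * (v x ^ 2 + (1 / 2) * dv x ^ 2)) volume a b :=
    hv.intervalIntegrable_quadratic (α := fun x => c x * v x ^ 2)
      (β := fun _ => 0) (γ := fun x => c x * (1 / 2))
      hsub (by fun_prop) (by fun_prop) (by fun_prop)
      fun x hx => by rw [hP x hx]; ring
  have h4 : IntervalIntegrable (fun x => v x * (v x ^ 2 + dv x ^ 2)) volume a b :=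
    hv.intervalIntegrable_quadratic (α := fun x => v x ^ 3)
      (β := fun _ => 0) (γ := v) hsub (by fun_prop) (by fun_prop) (by fun_prop)
      fun x hx => by ring
  refine ⟨h1, h2, h3, h4, ?_⟩
  have h0 : IntervalIntegrable v volume a b := hvc.intervalIntegrable a b
  have hftc := hv.integral_deriv_add_sq (p := fun x => 2 * (c x * s x)) (q := s)
    (by fun_prop) (by fun_prop) (fun x => ((hc x).mul (hs x)).const_mul 2) hs a b
  rw [← intervalIntegral.integral_congr_uIoo (f := fun x =>
      (P x + v x) * ((P x + v x) ^ 2 + (Q x + dv x) ^ 2) - P x * (P x ^ 2 + Q x ^ 2)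
        - k * v x - 2 * (P x * (v x ^ 2 + (1 / 2) * dv x ^ 2)) - v x * (v x ^ 2 + dv x ^ 2))
      fun x hx => by simp only [hP x hx, hQ x hx, ← hk x]; ring,
    intervalIntegral.integral_sub (((h1.sub h2).sub (h0.const_mul k)).sub (h3.const_mul 2)) h4,
    intervalIntegral.integral_sub ((h1.sub h2).sub (h0.const_mul k)) (h3.const_mul 2),
    intervalIntegral.integral_sub (h1.sub h2) (h0.const_mul k),
    intervalIntegral.integral_sub h1 h2, intervalIntegral.integral_const_mul,
    intervalIntegral.integral_const_mul] at hftc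
  linear_combination hftc

end Half

theorem wrap_of_mem_Ioo {x : ℝ} (hx : x ∈ Ioo (-π) π) : wrap x = x := by
  have hfloor : ⌊(x + π) / (2 * π)⌋ = 0 := by
    rw [Int.floor_eq_zero_iff, mem_Ico, div_lt_one two_pi_pos]
    exact ⟨div_nonneg (by linarith [hx.1]) two_pi_pos.le, by linarith [hx.2]⟩
  simp [wrap, hfloor]

theorem peak_of_pos {x : ℝ} (hx : x ∈ Ioo 0 π) : peak x = Real.cosh (π - x) / Real.sinh π := by
  rw [peak, wrap_of_mem_Ioo ⟨by linarith [hx.1, pi_pos], hx.2⟩, abs_of_pos hx.1]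

theorem peakDeriv_of_pos {x : ℝ} (hx : x ∈ Ioo 0 π) :
    peak' x = -Real.sinh (π - x) / Real.sinh π := by
  rw [peak', wrap_of_mem_Ioo ⟨by linarith [hx.1, pi_pos], hx.2⟩, abs_of_pos hx.1,
    Real.sign_of_pos hx.1, neg_one_mul]

theorem peak_of_neg {x : ℝ} (hx : x ∈ Ioo (-π) 0) :
    peak x = Real.cosh (π + x) / Real.sinh π := by
  rw [peak, wrap_of_mem_Ioo ⟨hx.1, by linarith [hx.2, pi_pos]⟩, abs_of_neg hx.2, sub_neg_eq_add]

theorem peakDeriv_of_neg {x : ℝ} (hx : x ∈ Ioo (-π) 0) :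
    peak' x = Real.sinh (π + x) / Real.sinh π := by
  rw [peak', wrap_of_mem_Ioo ⟨hx.1, by linarith [hx.2, pi_pos]⟩, abs_of_neg hx.2, sub_neg_eq_add,
    Real.sign_of_neg hx.2, neg_neg, one_mul]

/-- for `v ∈ H¹_per(T)` and `u = φ + v`, the conserved functionals
`E(u) = ∫_T (u² + u_x²)` and `F(u) = ∫_T u (u² + u_x²)` expand as
`E(u) = E(φ) + 4 v(0) + E(v)` and
`F(u) = F(φ) + 4M v(0) + m² ∫_T v + 2 ∫_T φ (v² + (1/2) v_x²) + 2 v(0)² + F(v)`. -/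
theorem energy_expansion (v dv : ℝ → ℝ) (hv : IsH1per v dv) :
    (∫ x in (-π)..π, ((peak x + v x) ^ 2 + (peak' x + dv x) ^ 2))
        = (∫ x in (-π)..π, ((peak x) ^ 2 + (peak' x) ^ 2)) + 4 * v 0
          + (∫ x in (-π)..π, ((v x) ^ 2 + (dv x) ^ 2)) ∧
      (∫ x in (-π)..π, (peak x + v x) * ((peak x + v x) ^ 2 + (peak' x + dv x) ^ 2))
        = (∫ x in (-π)..π, peak x * ((peak x) ^ 2 + (peak' x) ^ 2))
          + 4 * Mc * v 0 + mc ^ 2 * (∫ x in (-π)..π, v x)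
          + 2 * (∫ x in (-π)..π, peak x * ((v x) ^ 2 + (1 / 2) * (dv x) ^ 2))
          + 2 * (v 0) ^ 2
          + (∫ x in (-π)..π, v x * ((v x) ^ 2 + (dv x) ^ 2)) := by
  have hS : Real.sinh π ≠ 0 := (Real.sinh_pos_iff.mpr pi_pos).ne'
  have hvc : Continuous v := hv.2.2.1
  have hIl : uIoo (-π) 0 = Ioo (-π) 0 := uIoo_of_le (by linarith [pi_pos])
  have hIr : uIoo 0 π = Ioo 0 π := uIoo_of_le pi_pos.le
  have hzero : (0 : ℝ) ∈ uIcc (-π) π := by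
    rw [uIcc_of_le (by linarith [pi_pos])]
    exact ⟨by linarith [pi_pos], pi_pos.le⟩
  have hsubl : uIcc (-π) 0 ⊆ uIcc (-π) π := uIcc_subset_uIcc left_mem_uIcc hzero
  have hsubr : uIcc 0 π ⊆ uIcc (-π) π := uIcc_subset_uIcc hzero right_mem_uIcc
  have hcl (x : ℝ) : HasDerivAt (fun x => Real.cosh (π + x) / Real.sinh π)
      (Real.sinh (π + x) / Real.sinh π) x := by
    simpa using (((hasDerivAt_id x).const_add π).cosh).div_const (Real.sinh π)
  have hsl (x : ℝ) : HasDerivAt (fun x => Real.sinh (π + x) / Real.sinh π)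
      (Real.cosh (π + x) / Real.sinh π) x := by
    simpa using (((hasDerivAt_id x).const_add π).sinh).div_const (Real.sinh π)
  have hcr (x : ℝ) : HasDerivAt (fun x => Real.cosh (π - x) / Real.sinh π)
      (-Real.sinh (π - x) / Real.sinh π) x := by
    simpa using (((hasDerivAt_id x).const_sub π).cosh).div_const (Real.sinh π)
  have hsr (x : ℝ) : HasDerivAt (fun x => -Real.sinh (π - x) / Real.sinh π)
      (Real.cosh (π - x) / Real.sinh π) x := by
    simpa using ((((hasDerivAt_id x).const_sub π).sinh).neg).div_const (Real.sinh π)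
  have hclC : ContDiff ℝ 1 fun x => Real.cosh (π + x) / Real.sinh π := by fun_prop
  have hslC : ContDiff ℝ 1 fun x => Real.sinh (π + x) / Real.sinh π := by fun_prop
  have hcrC : ContDiff ℝ 1 fun x => Real.cosh (π - x) / Real.sinh π := by fun_prop
  have hsrC : ContDiff ℝ 1 fun x => -Real.sinh (π - x) / Real.sinh π := by fun_prop
  have hkl (x : ℝ) : (Real.cosh (π + x) / Real.sinh π) ^ 2 -
      (Real.sinh (π + x) / Real.sinh π) ^ 2 = mc ^ 2 := by
    rw [mc, div_pow, div_pow, div_pow, ← sub_div, Real.cosh_sq_sub_sinh_sq, one_pow]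
  have hkr (x : ℝ) : (Real.cosh (π - x) / Real.sinh π) ^ 2 -
      (-Real.sinh (π - x) / Real.sinh π) ^ 2 = mc ^ 2 := by
    rw [mc, div_pow, div_pow, div_pow, neg_sq, ← sub_div, Real.cosh_sq_sub_sinh_sq, one_pow]
  have hPl : ∀ x ∈ uIoo (-π) 0, peak x = Real.cosh (π + x) / Real.sinh π :=
    fun x hx => peak_of_neg (hIl ▸ hx)
  have hQl : ∀ x ∈ uIoo (-π) 0, peak' x = Real.sinh (π + x) / Real.sinh π :=
    fun x hx => peakDeriv_of_neg (hIl ▸ hx)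
  have hPr : ∀ x ∈ uIoo 0 π, peak x = Real.cosh (π - x) / Real.sinh π :=
    fun x hx => peak_of_pos (hIr ▸ hx)
  have hQr : ∀ x ∈ uIoo 0 π, peak' x = -Real.sinh (π - x) / Real.sinh π :=
    fun x hx => peakDeriv_of_pos (hIr ▸ hx)
  constructor
  · obtain ⟨l1, l2, l3, hl⟩ := hv.energy_expansion_interval hsubl hslC hclC hsl hPl hQl
    obtain ⟨r1, r2, r3, hr⟩ := hv.energy_expansion_interval hsubr hsrC hcrC hsr hPr hQr
    rw [← intervalIntegral.integral_add_adjacent_intervals l1 r1,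
      ← intervalIntegral.integral_add_adjacent_intervals l2 r2,
      ← intervalIntegral.integral_add_adjacent_intervals l3 r3, hl, hr]
    simp only [add_zero, sub_zero, add_neg_cancel, sub_self, Real.sinh_zero, neg_zero, zero_div,
      neg_div, div_self hS]
    ring
  · obtain ⟨l1, l2, l3, l4, hl⟩ :=
      hv.cubic_energy_expansion_interval hsubl hslC hclC hsl hcl hkl hPl hQl
    obtain ⟨r1, r2, r3, r4, hr⟩ :=
      hv.cubic_energy_expansion_interval hsubr hsrC hcrC hsr hcr hkr hPr hQr
    rw [← intervalIntegral.integral_add_adjacent_intervals l1 r1,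
      ← intervalIntegral.integral_add_adjacent_intervals l2 r2,
      ← intervalIntegral.integral_add_adjacent_intervals l3 r3,
      ← intervalIntegral.integral_add_adjacent_intervals l4 r4,
      ← intervalIntegral.integral_add_adjacent_intervals (hvc.intervalIntegrable (-π) 0)
        (hvc.intervalIntegrable 0 π), hl, hr]
    simp only [add_zero, sub_zero, add_neg_cancel, sub_self, Real.sinh_zero, neg_zero, zero_div,
      neg_div, div_self hS, Mc]
    ring
end

section
/- For every s ∈ [0,2π] and t ≥ 0, the function X(t,s) = log[((e^{2π} − e^s) + e^{2π−t}(e^s − 1)) / ((e^{2π} − e^s) + e^{−t}(e^s − 1))] is the unique solution of the characteristic initial-value problem dX/dt = φ̃(X) − M, X(0) = s, where φ̃(x) = m cosh(π − x) for x ∈ [0,2π]. Moreover X(t,0) = 0, X(t,2π) = 2π for all t ≥ 0, and ∂X/∂s(t,s) = (e^{2π}−1)² e^{s−t} / ([(e^{2π}−e^s) + e^{−t}(e^s−1)][(e^{2π}−e^s) + e^{2π−t}(e^s−1)]) > 0. -/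
open Real MeasureTheory Set Filter Topology

/-- The explicit characteristic curves
`X(t,s) = log [((e^{2π} - eˢ) + e^{2π-t}(eˢ - 1)) / ((e^{2π} - eˢ) + e^{-t}(eˢ - 1))]`. -/
noncomputable def Xc (t s : ℝ) : ℝ :=
  Real.log (((Real.exp (2 * π) - Real.exp s) + Real.exp (2 * π - t) * (Real.exp s - 1))
    / ((Real.exp (2 * π) - Real.exp s) + Real.exp (-t) * (Real.exp s - 1)))

/-- The explicit derivative `∂X/∂s(t,s)`. -/
noncomputable def Xs (t s : ℝ) : ℝ :=
  (Real.exp (2 * π) - 1) ^ 2 * Real.exp (s - t)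
    / (((Real.exp (2 * π) - Real.exp s) + Real.exp (-t) * (Real.exp s - 1))
        * ((Real.exp (2 * π) - Real.exp s) + Real.exp (2 * π - t) * (Real.exp s - 1)))

theorem exp_two_pi_gt_one : 1 < Real.exp (2 * π) :=
  Real.one_lt_exp_iff.mpr (by positivity)

theorem charDenom_pos {s t : ℝ} (hs : s ∈ Set.Icc (0:ℝ) (2 * π)) (ht : 0 ≤ t) :
    0 < (Real.exp (2 * π) - Real.exp s) + Real.exp (-t) * (Real.exp s - 1) := by
  have hu : Real.exp (-t) ≤ 1 := Real.exp_le_one_iff.mpr (by linarith)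
  have hE : Real.exp s ≤ Real.exp (2 * π) := Real.exp_le_exp.mpr hs.2
  nlinarith [mul_nonneg (sub_nonneg.mpr hu) (sub_nonneg.mpr hE),
    mul_pos (Real.exp_pos (-t)) (sub_pos.mpr exp_two_pi_gt_one)]

theorem charNum_pos {s t : ℝ} (hs : s ∈ Set.Icc (0:ℝ) (2 * π)) (ht : 0 ≤ t) :
    0 < (Real.exp (2 * π) - Real.exp s) + Real.exp (2 * π - t) * (Real.exp s - 1) := by
  have hx : 1 ≤ Real.exp s := Real.one_le_exp hs.1
  have hle : Real.exp (-t) ≤ Real.exp (2 * π - t) :=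
    Real.exp_le_exp.mpr (by linarith [Real.pi_pos])
  nlinarith [charDenom_pos hs ht, mul_nonneg (sub_nonneg.mpr hle) (sub_nonneg.mpr hx)]

theorem exp_Xc {s t : ℝ} (hs : s ∈ Set.Icc (0:ℝ) (2 * π)) (ht : 0 ≤ t) :
    Real.exp (Xc t s) =
      ((Real.exp (2 * π) - Real.exp s) + Real.exp (2 * π - t) * (Real.exp s - 1))
        / ((Real.exp (2 * π) - Real.exp s) + Real.exp (-t) * (Real.exp s - 1)) :=
  Real.exp_log (div_pos (charNum_pos hs ht) (charDenom_pos hs ht))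

theorem Xc_zero_left (s : ℝ) : Xc 0 s = s := by
  have hE : Real.exp (2 * π) - 1 ≠ 0 := (sub_pos.mpr exp_two_pi_gt_one).ne'
  have h : ((Real.exp (2 * π) - Real.exp s) + Real.exp (2 * π) * (Real.exp s - 1))
      / ((Real.exp (2 * π) - Real.exp s) + 1 * (Real.exp s - 1)) = Real.exp s := by
    rw [div_eq_iff (by convert hE using 1; ring)]
    ring
  simp only [Xc, sub_zero, neg_zero, Real.exp_zero, h, Real.log_exp]

theorem Xc_zero_right (t : ℝ) : Xc t 0 = 0 := by
  have hE : Real.exp (2 * π) - 1 ≠ 0 := (sub_pos.mpr exp_two_pi_gt_one).ne'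
  simp [Xc, hE]

theorem Xc_two_pi (t : ℝ) : Xc t (2 * π) = 2 * π := by
  have hE : Real.exp (2 * π) - 1 ≠ 0 := (sub_pos.mpr exp_two_pi_gt_one).ne'
  have hu : Real.exp (-t) ≠ 0 := (Real.exp_pos _).ne'
  simp only [Xc, sub_self, zero_add]
  rw [mul_div_mul_right _ _ hE, ← Real.exp_sub, Real.log_exp]
  ring

theorem charField_eq_exp (x : ℝ) :
    mc * Real.cosh (π - x) - Mc =
      (Real.exp x - 1) * (Real.exp x - Real.exp (2 * π))
        / (Real.exp x * (Real.exp (2 * π) - 1)) := by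
  have hE : Real.exp (2 * π) = Real.exp π ^ 2 := by rw [← Real.exp_nat_mul]; norm_num
  have h1 : Real.exp π ^ 2 - 1 ≠ 0 := by
    rw [← hE]; exact (sub_pos.mpr exp_two_pi_gt_one).ne'
  have hp : Real.exp π ≠ 0 := (Real.exp_pos _).ne'
  have hx : Real.exp x ≠ 0 := (Real.exp_pos _).ne'
  have hS : Real.sinh π = (Real.exp π ^ 2 - 1) / (2 * Real.exp π) := by
    rw [Real.sinh_eq, Real.exp_neg]; field_simp
  rw [mc, Mc, hS, hE, Real.cosh_eq, Real.cosh_eq, neg_sub, Real.exp_sub, Real.exp_sub,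
    Real.exp_neg]
  field_simp
  ring

theorem hasDerivAt_Xc_time {s t : ℝ} (hs : s ∈ Set.Icc (0:ℝ) (2 * π)) (ht : 0 ≤ t) :
    HasDerivAt (fun τ => Xc τ s) (mc * Real.cosh (π - Xc t s) - Mc) t := by
  have hN := charNum_pos hs ht
  have hD := charDenom_pos hs ht
  have hE := sub_pos.mpr exp_two_pi_gt_one
  have dN : HasDerivAt (fun τ => (Real.exp (2 * π) - Real.exp s)
      + Real.exp (2 * π - τ) * (Real.exp s - 1))
      (Real.exp (2 * π - t) * (-1) * (Real.exp s - 1)) t :=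
    ((((hasDerivAt_id t).const_sub (2 * π)).exp).mul_const _).const_add _
  have dD : HasDerivAt (fun τ => (Real.exp (2 * π) - Real.exp s)
      + Real.exp (-τ) * (Real.exp s - 1))
      (Real.exp (-t) * (-1) * (Real.exp s - 1)) t :=
    ((((hasDerivAt_id t).neg).exp).mul_const _).const_add _
  refine ((dN.div dD hD.ne').log (div_pos hN hD).ne').congr_deriv ?_
  rw [charField_eq_exp, exp_Xc hs ht]
  have hu : Real.exp (2 * π - t) = Real.exp (2 * π) * Real.exp (-t) := by
    rw [← Real.exp_add, sub_eq_add_neg]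
  simp only [Pi.div_apply]
  rw [hu] at hN ⊢
  generalize Real.exp (2 * π) = E at *
  generalize Real.exp (-t) = u at *
  generalize Real.exp s = x at *
  have h1 := hN.ne'
  have h2 := hD.ne'
  have h3 := hE.ne'
  field_simp
  ring

theorem hasDerivAt_Xc_label {s t : ℝ} (hs : s ∈ Set.Icc (0:ℝ) (2 * π)) (ht : 0 ≤ t) :
    HasDerivAt (fun σ => Xc t σ) (Xs t s) s := by
  have hN := charNum_pos hs ht
  have hD := charDenom_pos hs ht
  have dN (c : ℝ) : HasDerivAt (fun σ => (Real.exp (2 * π) - Real.exp σ)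
      + c * (Real.exp σ - 1)) (-Real.exp s + c * Real.exp s) s :=
    ((Real.hasDerivAt_exp s).const_sub _).add (((Real.hasDerivAt_exp s).sub_const 1).const_mul c)
  refine (((dN _).div (dN _) hD.ne').log (div_pos hN hD).ne').congr_deriv ?_
  have hu : Real.exp (2 * π - t) = Real.exp (2 * π) * Real.exp (-t) := by
    rw [← Real.exp_add, sub_eq_add_neg]
  have hv : Real.exp (s - t) = Real.exp s * Real.exp (-t) := by
    rw [← Real.exp_add, sub_eq_add_neg]
  simp only [Pi.div_apply, Xs]
  rw [hv]
  rw [hu] at hN ⊢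
  generalize Real.exp (2 * π) = E at *
  generalize Real.exp (-t) = u at *
  generalize Real.exp s = x at *
  have h1 := hN.ne'
  have h2 := hD.ne'
  field_simp
  ring

theorem Xs_pos {s t : ℝ} (hs : s ∈ Set.Icc (0:ℝ) (2 * π)) (ht : 0 ≤ t) : 0 < Xs t s :=
  div_pos (mul_pos (pow_pos (sub_pos.mpr exp_two_pi_gt_one) 2) (Real.exp_pos _))
    (mul_pos (charDenom_pos hs ht) (charNum_pos hs ht))

/-- Forward uniqueness for an autonomous scalar equation with a `C¹` right-hand side. -/
theorem eq_of_hasDerivWithinAt_Ici_of_contDiff {F : ℝ → ℝ} (hF : ContDiff ℝ 1 F)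
    {Y Z : ℝ → ℝ} (h0 : Y 0 = Z 0)
    (hY : ∀ t : ℝ, 0 ≤ t → HasDerivWithinAt Y (F (Y t)) (Set.Ici 0) t)
    (hZ : ∀ t : ℝ, 0 ≤ t → HasDerivWithinAt Z (F (Z t)) (Set.Ici 0) t)
    {t : ℝ} (ht : 0 ≤ t) : Y t = Z t := by
  have cY : ContinuousOn Y (Set.Icc 0 t) := fun r hr =>
    (hY r hr.1).continuousWithinAt.mono Set.Icc_subset_Ici_self
  have cZ : ContinuousOn Z (Set.Icc 0 t) := fun r hr =>
    (hZ r hr.1).continuousWithinAt.mono Set.Icc_subset_Ici_self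
  obtain ⟨R, hR⟩ := ((isCompact_Icc.image_of_continuousOn cY).union
    (isCompact_Icc.image_of_continuousOn cZ)).isBounded.subset_closedBall (0 : ℝ)
  obtain ⟨K, hK⟩ := hF.contDiffOn.exists_lipschitzOnWith one_ne_zero
    (convex_closedBall (0 : ℝ) R) (isCompact_closedBall 0 R)
  refine ODE_solution_unique_of_mem_Icc_right (v := fun _ => F)
    (s := fun _ => Metric.closedBall 0 R) (K := K) (fun _ _ => hK) cY
    (fun r hr => (hY r hr.1).mono (Set.Ici_subset_Ici.mpr hr.1))
    (fun r hr => hR (Or.inl ⟨r, Set.Ico_subset_Icc_self hr, rfl⟩)) cZ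
    (fun r hr => (hZ r hr.1).mono (Set.Ici_subset_Ici.mpr hr.1))
    (fun r hr => hR (Or.inr ⟨r, Set.Ico_subset_Icc_self hr, rfl⟩)) h0 (Set.right_mem_Icc.mpr ht)

/-- for every `s ∈ [0, 2π]`, `X(t,s)` is the unique solution of the
characteristic initial-value problem `dX/dt = φ̃(X) - M`, `X(0) = s`, where
`φ̃(x) = m cosh(π - x)` on `[0, 2π]`; moreover `X(t,0) = 0`, `X(t,2π) = 2π`, and
`∂X/∂s(t,s) = (e^{2π}-1)² e^{s-t} / ([(e^{2π}-eˢ) + e^{-t}(eˢ-1)][(e^{2π}-eˢ) + e^{2π-t}(eˢ-1)]) > 0`. -/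
theorem characteristics_explicit (s : ℝ) (hs : s ∈ Set.Icc (0:ℝ) (2 * π)) :
    Xc 0 s = s ∧
    (∀ t : ℝ, 0 ≤ t →
      HasDerivWithinAt (fun τ => Xc τ s)
        (mc * Real.cosh (π - Xc t s) - Mc) (Set.Ici 0) t) ∧
    (∀ Y : ℝ → ℝ, Y 0 = s →
      (∀ t : ℝ, 0 ≤ t →
        HasDerivWithinAt Y (mc * Real.cosh (π - Y t) - Mc) (Set.Ici 0) t) →
      ∀ t : ℝ, 0 ≤ t → Y t = Xc t s) ∧
    (∀ t : ℝ, 0 ≤ t → Xc t 0 = 0 ∧ Xc t (2 * π) = 2 * π) ∧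
    (∀ t : ℝ, 0 ≤ t → HasDerivAt (fun σ => Xc t σ) (Xs t s) s ∧ 0 < Xs t s) := by
  have hX : ∀ t : ℝ, 0 ≤ t → HasDerivWithinAt (fun τ => Xc τ s)
      (mc * Real.cosh (π - Xc t s) - Mc) (Set.Ici 0) t := fun t ht =>
    (hasDerivAt_Xc_time hs ht).hasDerivWithinAt
  have hF : ContDiff ℝ 1 (fun x : ℝ => mc * Real.cosh (π - x) - Mc) := by fun_prop
  exact ⟨Xc_zero_left s, hX,
    fun Y hY0 hY t ht => eq_of_hasDerivWithinAt_Ici_of_contDiff hF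
      (hY0.trans (Xc_zero_left s).symm) hY hX ht,
    fun t _ => ⟨Xc_zero_right t, Xc_two_pi t⟩,
    fun t ht => ⟨hasDerivAt_Xc_label hs ht, Xs_pos hs ht⟩⟩
end
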